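/- Let G be a 2-connected finite simple graph containing an odd cycle, and let t be any vertex of G. Then t lies on some odd cycle of G. -/

import Mathlib

open SimpleGraph

/-- A graph is 2-connected: connected, at least 3 vertices, and still connected after
deleting any single vertex. -/
def TwoConnected {V : Type*} (G : SimpleGraph V) : Prop :=
  G.Connected ∧ 3 ≤ Nat.card V ∧ ∀ v : V, (G.induce {u | u ≠ v}).Connected

namespace SimpleGraph

variable {V : Type*} {G : SimpleGraph V}

/-- Every walk ending in a set `S` contains a path from its start to `S` which meets `S` only at
its end. -/
lemma Walk.exists_isPath_first_hit {S : Set V} {a b : V} (p : G.Walk a b) (hb : b ∈ S) :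
    ∃ w ∈ S, ∃ q : G.Walk a w, q.IsPath ∧ q.support ⊆ p.support ∧
      ∀ x ∈ q.support, x ∈ S → x = w := by
  classical
  suffices h : ∃ w ∈ S, ∃ q : G.Walk a w, q.support ⊆ p.support ∧
      ∀ x ∈ q.support, x ∈ S → x = w by
    obtain ⟨w, hw, q, hq, hS⟩ := h
    exact ⟨w, hw, q.bypass, q.bypass_isPath,
      fun x hx => hq (q.support_bypass_subset_support hx),
      fun x hx => hS x (q.support_bypass_subset_support hx)⟩
  induction p with
  | nil => exact ⟨_, hb, .nil, by simp, by simp⟩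
  | @cons u v w h p ih =>
    by_cases hu : u ∈ S
    · exact ⟨u, hu, .nil, by simp, by simp⟩
    · obtain ⟨z, hz, q, hq, hS⟩ := ih hb
      refine ⟨z, hz, .cons h q, ?_, ?_⟩
      · simpa using List.cons_subset_cons u hq
      · intro x hx hxS
        rcases List.mem_cons.1 (by simpa using hx) with rfl | hx
        · exact absurd hxS hu
        · exact hS x hx hxS

/-- The concatenation of two paths that meet only at their common endpoint is a path. -/
lemma Walk.IsPath.append_of_support_inter {a b c : V} {p : G.Walk a b} {q : G.Walk b c}
    (hp : p.IsPath) (hq : q.IsPath) (h : ∀ x ∈ p.support, x ∈ q.support → x = b) :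
    (p.append q).IsPath := by
  rw [Walk.isPath_def, Walk.support_append, List.nodup_append']
  refine ⟨hp.support_nodup, hq.support_nodup.tail, fun x hx hxq => ?_⟩
  obtain rfl := h x hx (List.mem_of_mem_tail hxq)
  have hn := hq.support_nodup
  rw [← Walk.cons_tail_support] at hn
  exact (List.nodup_cons.1 hn).1 hxq

/-- If deleting `u` leaves a connected graph and `u` lies on an odd cycle, then so does every
neighbour of `u`. -/
lemma exists_odd_cycle_of_adj {u v : V} (hconn : (G.induce {x | x ≠ u}).Connected)
    (huv : G.Adj u v) {c : G.Walk u u} (hc : c.IsCycle) (hodd : Odd c.length) :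
    ∃ (z : V) (d : G.Walk z z), d.IsCycle ∧ Odd d.length ∧ v ∈ d.support := by
  classical
  by_cases hv : v ∈ c.support
  · exact ⟨u, c, hc, hodd, hv⟩
  have hsnd : c.snd ≠ u := (c.adj_snd hc.not_nil).ne'
  obtain ⟨p⟩ := hconn.preconnected ⟨v, huv.ne'⟩ ⟨c.snd, hsnd⟩
  let p' : G.Walk v c.snd := p.map (Embedding.induce _).toHom
  obtain ⟨w, hwc, q, hq, hqp, hqc⟩ :=
    p'.exists_isPath_first_hit (S := {x | x ∈ c.support})
      (c.getVert_mem_support 1)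
  have huq : u ∉ q.support := fun hu => by
    have := hqp hu
    rw [show p'.support = _ from Walk.support_map .., List.mem_map] at this
    obtain ⟨⟨x, hx⟩, -, hxu⟩ := this
    exact hx hxu
  have hwu : w ≠ u := fun h => huq (h ▸ q.end_mem_support)
  have key : ∀ r : G.Walk w u, r.IsPath → r.support ⊆ c.support → Odd (q.length + r.length + 1) →
      ∃ (z : V) (d : G.Walk z z), d.IsCycle ∧ Odd d.length ∧ v ∈ d.support := by
    intro r hr hrc hl
    refine ⟨u, .cons huv (q.append r), ?_, by simpa using hl, by simp⟩
    rw [Walk.cons_isCycle_iff]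
    refine ⟨hq.append_of_support_inter hr fun x hx hxr => hqc x hx (hrc hxr), fun he => ?_⟩
    rw [Walk.edges_append, List.mem_append] at he
    rcases he with he | he
    · exact huq (q.fst_mem_support_of_mem_edges he)
    · exact hv (hrc (r.snd_mem_support_of_mem_edges he))
  have hwc' : w ∈ c.support := hwc
  have hlen : (c.takeUntil w hwc').length + (c.dropUntil w hwc').length = c.length := by
    rw [← Walk.length_append, Walk.take_spec]
  by_cases hpar : Odd (q.length + (c.dropUntil w hwc').length + 1)
  · refine key _ ?_ (c.support_dropUntil_subset_support hwc') hpar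
    rw [← c.take_spec hwc'] at hc
    exact hc.isPath_of_append_right (Walk.not_nil_of_ne hwu.symm)
  · refine key _ (hc.isPath_takeUntil hwc').reverse ?_ ?_
    · intro x hx
      rw [Walk.support_reverse, List.mem_reverse] at hx
      exact c.support_takeUntil_subset_support hwc' hx
    · rw [Walk.length_reverse]
      grind

end SimpleGraph

theorem stmt_2 {V : Type*} [Fintype V] (G : SimpleGraph V)
    (h2c : TwoConnected G)
    (hodd : ∃ (u : V) (c : G.Walk u u), c.IsCycle ∧ Odd c.length)
    (t : V) :
    ∃ (u : V) (c : G.Walk u u), c.IsCycle ∧ Odd c.length ∧ t ∈ c.support := by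
  classical
  obtain ⟨hconn, -, hdel⟩ := h2c
  obtain ⟨u, c, hc, hco⟩ := hodd
  obtain ⟨p⟩ := hconn.preconnected u t
  have hu : ∃ (z : V) (d : G.Walk z z), d.IsCycle ∧ Odd d.length ∧ u ∈ d.support :=
    ⟨u, c, hc, hco, c.start_mem_support⟩
  clear hc hco c
  induction p with
  | nil => exact hu
  | @cons u v w h p ih =>
    obtain ⟨z, d, hd, hdo, hud⟩ := hu
    exact ih (exists_odd_cycle_of_adj (hdel u) h (hd.rotate hud)
      (by rwa [Walk.length_rotate]))
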